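/- arXiv:2512.19278 — 3 statements merged into one kernel-verified Lean document; each statement's English description precedes it below -/
import Mathlib

section
/- For every integer n > 3 there exists an even-regular closed XOR-magic graph of power n; that is, there exist an even positive integer k and a connected k-regular simple graph G on 2^n vertices together with a bijection ℓ from V(G) to (Z_2)^n such that for every vertex v the sum in (Z_2)^n of ℓ(u) over all vertices u of the closed neighborhood N[v] = N(v) ∪ {v} is the zero vector. -/
/-- `G` is connected, regular of even positive degree `k`, and the labels of the neighbors of each
vertex add up to the label of that vertex. -/
structure IsEvenMagicLabeling {V A : Type*} [AddCommGroup A] (G : SimpleGraph V) (ℓ : V ≃ A)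
    (k : ℕ) : Prop where
  even : Even k
  pos : 0 < k
  ncard_neighborSet (v : V) : (G.neighborSet v).ncard = k
  connected : G.Connected
  sum_neighborSet (v : V) : ∑ᶠ u ∈ G.neighborSet v, ℓ u = ℓ v

/-- The group `A` labels some even-regular graph on `V`. -/
def HasEvenMagicLabeling (V A : Type*) [AddCommGroup A] : Prop :=
  ∃ (k : ℕ) (G : SimpleGraph V) (ℓ : V ≃ A), IsEvenMagicLabeling G ℓ k

theorem Even.nsmul_eq_zero_of_add_self {A : Type*} [AddCommGroup A] {k : ℕ} (hk : Even k) {a : A}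
    (ha : a + a = 0) : k • a = 0 := by
  obtain ⟨m, rfl⟩ := hk
  rw [add_nsmul, ← nsmul_add, ha, nsmul_zero]

namespace HasEvenMagicLabeling

variable {V W A B : Type*} [AddCommGroup A] [AddCommGroup B]

theorem congr (h : HasEvenMagicLabeling V A) (e : W ≃ V) (f : A ≃+ B) :
    HasEvenMagicLabeling W B := by
  obtain ⟨k, G, ℓ, hk, hpos, hcard, hconn, hsum⟩ := h
  have hN (v : W) : e '' (G.comap e).neighborSet v = G.neighborSet (e v) := by
    change e '' (e ⁻¹' _) = _
    exact Set.image_preimage_eq _ e.surjective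
  refine ⟨k, G.comap e, (e.trans ℓ).trans f.toEquiv, hk, hpos, fun v => ?_, ?_, fun v => ?_⟩
  · rw [← hcard (e v), ← hN, Set.ncard_image_of_injective _ e.injective]
  · exact (SimpleGraph.Iso.comap e G).connected_iff.mpr hconn
  · have hfin : (G.neighborSet (e v)).Finite :=
      Set.finite_of_ncard_pos (by rw [hcard]; exact hpos)
    have := congrArg f (hsum (e v))
    rw [← AddEquiv.coe_toAddMonoidHom, AddMonoidHom.map_finsum_mem _ _ hfin, ← hN,
      finsum_mem_image e.injective.injOn] at this
    exact this

theorem prod (hA : ∀ a : A, a + a = 0) (hB : ∀ b : B, b + b = 0)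
    (h : HasEvenMagicLabeling V A) (h' : HasEvenMagicLabeling W B) :
    HasEvenMagicLabeling (V × W) (A × B) := by
  obtain ⟨k, G, ℓ, hk, hpos, hcard, hconn, hsum⟩ := h
  obtain ⟨m, H, μ, hm, hpos', hcard', hconn', hsum'⟩ := h'
  have hG (v : V) : (G.neighborSet v).Finite :=
    Set.finite_of_ncard_pos (by rw [hcard]; exact hpos)
  have hH (w : W) : (H.neighborSet w).Finite :=
    Set.finite_of_ncard_pos (by rw [hcard']; exact hpos')
  have hN (v : V) (w : W) : (G □ H).neighborSet (v, w) =
      (fun a => (a, w)) '' G.neighborSet v ∪ (fun b => (v, b)) '' H.neighborSet w := by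
    rw [SimpleGraph.neighborSet_boxProd, Set.prod_singleton, Set.singleton_prod]
  have hdisj (v : V) (w : W) : Disjoint ((fun a => (a, w)) '' G.neighborSet v)
      ((fun b => (v, b)) '' H.neighborSet w) := by
    rw [Set.disjoint_left]
    rintro _ ⟨a, ha, rfl⟩ ⟨b, -, hab⟩
    obtain ⟨rfl, -⟩ := Prod.ext_iff.mp hab
    exact G.irrefl ha
  refine ⟨k + m, G □ H, ℓ.prodCongr μ, hk.add hm, by lia, ?_, hconn.boxProd hconn', ?_⟩
  · rintro ⟨v, w⟩
    rw [hN, Set.ncard_union_eq (hdisj v w) ((hG v).image _) ((hH w).image _),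
      Set.ncard_image_of_injective _ (Prod.mk_left_injective w),
      Set.ncard_image_of_injective _ (Prod.mk_right_injective v), hcard, hcard']
  · rintro ⟨v, w⟩
    rw [hN, finsum_mem_union (hdisj v w) ((hG v).image _) ((hH w).image _),
      finsum_mem_image (Prod.mk_left_injective w).injOn,
      finsum_mem_image (Prod.mk_right_injective v).injOn,
      finsum_mem_eq_finite_toFinset_sum _ (hG v), finsum_mem_eq_finite_toFinset_sum _ (hH w)]
    have hs := hsum v
    have hs' := hsum' w
    rw [finsum_mem_eq_finite_toFinset_sum _ (hG v)] at hs
    rw [finsum_mem_eq_finite_toFinset_sum _ (hH w)] at hs'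
    have hc : (hG v).toFinset.card = k := by
      rw [← Set.ncard_eq_toFinset_card _ (hG v), hcard]
    have hc' : (hH w).toFinset.card = m := by
      rw [← Set.ncard_eq_toFinset_card _ (hH w), hcard']
    ext
    · simp [Prod.fst_sum, hs, hc', hm.nsmul_eq_zero_of_add_self (hA _)]
    · simp [Prod.snd_sum, hs', hc, hk.nsmul_eq_zero_of_add_self (hB _)]

end HasEvenMagicLabeling

/-- The `n` lowest binary digits of a natural number. -/
def binaryDigits (n v : ℕ) : Fin n → ZMod 2 := fun i => if v.testBit i then 1 else 0

theorem binaryDigits_xor (n v w : ℕ) :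
    binaryDigits n (v ^^^ w) = binaryDigits n v + binaryDigits n w := by
  ext i
  simp only [binaryDigits, Nat.testBit_xor, Pi.add_apply]
  cases v.testBit i <;> cases w.testBit i <;> decide

theorem sum_map_binaryDigits (n : ℕ) (l : List ℕ) :
    (l.map (binaryDigits n)).sum = binaryDigits n (l.foldr (· ^^^ ·) 0) := by
  induction l with
  | nil => ext; simp [binaryDigits]
  | cons v l ih => simp [ih, binaryDigits_xor]

theorem binaryDigits_bijective (n : ℕ) :
    Function.Bijective fun v : Fin (2 ^ n) => binaryDigits n v := by
  rw [Fintype.bijective_iff_injective_and_card]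
  refine ⟨fun v w h => Fin.ext (Nat.eq_of_testBit_eq fun i => ?_), by simp⟩
  by_cases hi : i < n
  · have := congrFun h ⟨i, hi⟩
    simp only [binaryDigits] at this
    revert this
    cases (v : ℕ).testBit i <;> cases (w : ℕ).testBit i <;> decide
  · have hpow : 2 ^ n ≤ 2 ^ i := Nat.pow_le_pow_right two_pos (not_lt.mp hi)
    rw [Nat.testBit_lt_two_pow (v.isLt.trans_le hpow),
      Nat.testBit_lt_two_pow (w.isLt.trans_le hpow)]

/-- The lists `N v` are the neighborhoods of a graph on the vertices `v < 2 ^ n` in which each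
vertex is the bitwise sum of its neighbors and each nonzero vertex has a smaller neighbor. -/
def IsXorNeighborhood (n : ℕ) (N : ℕ → List ℕ) : Prop :=
  ∀ v < 2 ^ n, (N v).Nodup ∧ v ∉ N v ∧ (∀ w ∈ N v, w < 2 ^ n ∧ v ∈ N w) ∧
    (N v).foldr (· ^^^ ·) 0 = v ∧ (v = 0 ∨ ∃ w ∈ N v, w < v)

instance (n : ℕ) (N : ℕ → List ℕ) : Decidable (IsXorNeighborhood n N) :=
  inferInstanceAs (Decidable (∀ v < 2 ^ n, _))

theorem IsXorNeighborhood.hasEvenMagicLabeling {n k : ℕ} {N : ℕ → List ℕ}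
    (h : IsXorNeighborhood n N) (hk : Even k) (hpos : 0 < k) (hlen : ∀ v, (N v).length = k) :
    HasEvenMagicLabeling (Fin (2 ^ n)) (Fin n → ZMod 2) := by
  let G : SimpleGraph (Fin (2 ^ n)) :=
    { Adj v w := (w : ℕ) ∈ N v
      symm := ⟨fun v w hvw => ((h v v.isLt).2.2.1 w hvw).2⟩
      loopless := ⟨fun v => (h v v.isLt).2.1⟩ }
  have hN (v : Fin (2 ^ n)) : Fin.val '' G.neighborSet v = (N v).toFinset := by
    ext w
    simp only [Set.mem_image, SimpleGraph.mem_neighborSet, List.coe_toFinset, Set.mem_ofPred_eq]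
    exact ⟨by rintro ⟨w, hw, rfl⟩; exact hw,
      fun hw => ⟨⟨w, ((h v v.isLt).2.2.1 w hw).1⟩, hw, rfl⟩⟩
  refine ⟨k, G, .ofBijective _ (binaryDigits_bijective n), hk, hpos, fun v => ?_, ?_, fun v => ?_⟩
  · rw [← Set.ncard_image_of_injective _ Fin.val_injective, hN, Set.ncard_coe_finset,
      List.toFinset_card_of_nodup (h v v.isLt).1, hlen]
  · have hreach (m : ℕ) (hm : m < 2 ^ n) : G.Reachable ⟨m, hm⟩ ⟨0, by positivity⟩ := by
      induction m using Nat.strong_induction_on with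
      | _ m ih =>
        obtain rfl | ⟨w, hw, hlt⟩ := (h m hm).2.2.2.2
        · rfl
        · have hadj : G.Adj ⟨m, hm⟩ ⟨w, hlt.trans hm⟩ := hw
          exact hadj.reachable.trans (ih w hlt _)
    exact ⟨fun v w => (hreach v v.isLt).trans (hreach w w.isLt).symm⟩
  · simp only [Equiv.ofBijective_apply]
    rw [← finsum_mem_image (f := binaryDigits n) Fin.val_injective.injOn, hN,
      finsum_mem_coe_finset, List.sum_toFinset _ (h v v.isLt).1, sum_map_binaryDigits,
      (h v v.isLt).2.2.2.1]

/-- The bitwise sum of the entries of a list selected by the binary digits of a number. -/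
def xorSelect : List ℕ → ℕ → ℕ
  | [], _ => 0
  | c :: cs, v => (if v % 2 = 1 then c else 0) ^^^ xorSelect cs (v / 2)

/-- The images of `v` under affine maps of `𝔽₂ⁿ`, each given by its translation part followed by
the columns of its linear part. -/
def affineImages (maps : List (List ℕ)) (v : ℕ) : List ℕ :=
  maps.map fun columns => xorSelect columns (2 * v + 1)

theorem hasEvenMagicLabeling_of_maps {n : ℕ} (maps : List (List ℕ)) (hk : Even maps.length)
    (hpos : 0 < maps.length) (h : IsXorNeighborhood n (affineImages maps)) :
    HasEvenMagicLabeling (Fin (2 ^ n)) (Fin n → ZMod 2) :=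
  h.hasEvenMagicLabeling hk hpos fun _ => List.length_map _

theorem hasEvenMagicLabeling_four : HasEvenMagicLabeling (Fin (2 ^ 4)) (Fin 4 → ZMod 2) :=
  hasEvenMagicLabeling_of_maps
    [[4, 12, 2, 4, 5], [15, 6, 5, 4, 8], [2, 15, 2, 4, 8], [3, 4, 7, 1, 13], [11, 1, 2, 5, 8],
      [1, 1, 2, 4, 8]] (by decide) (by decide) (by decide +kernel)

theorem hasEvenMagicLabeling_five : HasEvenMagicLabeling (Fin (2 ^ 5)) (Fin 5 → ZMod 2) :=
  hasEvenMagicLabeling_of_maps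
    [[14, 19, 2, 16, 12, 21], [10, 7, 2, 19, 27, 4], [1, 1, 2, 8, 4, 28], [17, 20, 23, 4, 8, 5],
      [5, 1, 21, 4, 31, 7], [2, 1, 2, 15, 8, 27], [3, 1, 2, 4, 12, 20], [16, 1, 2, 4, 8, 16]]
    (by decide) (by decide) (by decide +kernel)

theorem hasEvenMagicLabeling_six : HasEvenMagicLabeling (Fin (2 ^ 6)) (Fin 6 → ZMod 2) :=
  hasEvenMagicLabeling_of_maps
    [[5, 1, 2, 4, 36, 16, 12], [37, 39, 36, 34, 8, 16, 32], [2, 27, 2, 30, 8, 16, 32],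
      [45, 24, 2, 4, 8, 9, 57], [48, 37, 38, 32, 44, 52, 4], [15, 1, 2, 4, 8, 33, 17],
      [1, 1, 2, 24, 8, 12, 32], [49, 1, 2, 4, 8, 16, 32]]
    (by decide) (by decide) (by decide +kernel)

theorem hasEvenMagicLabeling_seven : HasEvenMagicLabeling (Fin (2 ^ 7)) (Fin 7 → ZMod 2) :=
  hasEvenMagicLabeling_of_maps
    [[29, 25, 8, 90, 70, 94, 126, 64], [21, 25, 92, 20, 2, 26, 48, 64],
      [26, 76, 2, 4, 8, 16, 109, 13], [58, 49, 50, 4, 56, 32, 16, 112],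
      [34, 1, 52, 50, 8, 38, 22, 118], [1, 1, 2, 4, 8, 101, 85, 64],
      [92, 81, 82, 84, 88, 64, 112, 16], [55, 45, 2, 40, 36, 16, 32, 108],
      [2, 1, 2, 4, 8, 103, 32, 55], [98, 1, 2, 4, 8, 16, 32, 64]]
    (by decide) (by decide) (by decide +kernel)

theorem hasEvenMagicLabeling (n : ℕ) (hn : 3 < n) :
    HasEvenMagicLabeling (Fin (2 ^ n)) (Fin n → ZMod 2) := by
  induction n using Nat.strong_induction_on with
  | _ n ih =>
    by_cases h : n < 8
    · interval_cases n
      · exact hasEvenMagicLabeling_four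
      · exact hasEvenMagicLabeling_five
      · exact hasEvenMagicLabeling_six
      · exact hasEvenMagicLabeling_seven
    · obtain ⟨m, rfl⟩ : ∃ m, n = m + 4 := ⟨n - 4, by lia⟩
      refine ((ih m (by lia) (by lia)).prod (fun _ => funext fun _ => CharTwo.add_self_eq_zero _)
        (fun _ => funext fun _ => CharTwo.add_self_eq_zero _)
        hasEvenMagicLabeling_four).congr ((finCongr (pow_add 2 m 4)).trans finProdFinEquiv.symm)
        { Fin.appendEquiv m 4 with map_add' := fun a b => ?_ }
      ext i
      refine Fin.addCases (fun j => ?_) (fun j => ?_) i <;> simp [Fin.appendEquiv]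

theorem stmt_1 (n : ℕ) (hn : 3 < n) :
    ∃ (k : ℕ) (G : SimpleGraph (Fin (2 ^ n))),
      Even k ∧ 0 < k ∧
      (∀ v, (G.neighborSet v).ncard = k) ∧
      G.Connected ∧
      ∃ ℓ : Fin (2 ^ n) ≃ (Fin n → ZMod 2),
        ∀ v, ∑ᶠ u ∈ insert v (G.neighborSet v), ℓ u = 0 := by
  obtain ⟨k, G, ℓ, hk, hpos, hcard, hconn, hsum⟩ := hasEvenMagicLabeling n hn
  refine ⟨k, G, hk, hpos, hcard, hconn, ℓ, fun v => ?_⟩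
  have hv : v ∉ G.neighborSet v := G.irrefl
  rw [finsum_mem_insert _ hv (Set.toFinite _), hsum]
  exact funext fun _ => CharTwo.add_self_eq_zero _
end

section
/- For each of the following pairs (n,k) — n = 4 with k ∈ {5,7,9,11}; n = 5 with k ∈ {5,7,9,11,13,15,27}; n = 6 with k = 9; n = 7 with k = 13 — there exists a connected k-regular simple graph G on 2^n vertices together with a bijection ℓ from V(G) to (Z_2)^n such that for every vertex v the sum in (Z_2)^n of ℓ(u) over all neighbors u of v is the zero vector (i.e., a k-regular open XOR-magic graph of power n exists). -/
/-- The graph on `Fin N` in which `u < v` are adjacent iff bit `u` of entry `v - 1` of `rows` is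
set. -/
def graphOfRows (N : ℕ) (rows : List ℕ) : SimpleGraph (Fin N) :=
  SimpleGraph.fromRel fun u v => u < v ∧ (rows.getD (v - 1) 0).testBit u

instance (N : ℕ) (rows : List ℕ) : DecidableRel (graphOfRows N rows).Adj := fun u v =>
  decidable_of_iff (u ≠ v ∧ (_ ∨ _)) (SimpleGraph.fromRel_adj _ u v).symm

/-- A graph on `Fin N` is connected if every nonzero vertex has a smaller neighbor. -/
theorem SimpleGraph.connected_of_exists_adj_lt {N : ℕ} [NeZero N] (G : SimpleGraph (Fin N))
    (h : ∀ v, v ≠ 0 → ∃ u < v, G.Adj u v) : G.Connected := by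
  rw [SimpleGraph.connected_iff_exists_forall_reachable]
  refine ⟨0, fun v => ?_⟩
  induction v using WellFoundedLT.induction with
  | ind v ih =>
    by_cases hv : v = 0
    · rw [hv]
    · obtain ⟨u, huv, hadj⟩ := h v hv
      exact (ih u huv).trans hadj.reachable

/-- There is a connected `k`-regular graph on `2 ^ n` vertices with an open XOR-magic labeling. -/
def ExistsOpenXorMagic (n k : ℕ) : Prop :=
  ∃ G : SimpleGraph (Fin (2 ^ n)),
    G.Connected ∧
    (∀ v, (G.neighborSet v).ncard = k) ∧
    ∃ ℓ : Fin (2 ^ n) ≃ (Fin n → ZMod 2),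
      ∀ v, ∑ᶠ u ∈ G.neighborSet v, ℓ u = 0

/-- A regular graph on `Fin (2 ^ n)` is open XOR-magic with respect to binary expansion of the
vertices if each binary digit is set in an even number of the neighbors of every vertex. -/
theorem existsOpenXorMagic_of_even {n k : ℕ} (G : SimpleGraph (Fin (2 ^ n)))
    [DecidableRel G.Adj] (hconn : ∀ v, v ≠ 0 → ∃ u < v, G.Adj u v)
    (hdeg : ∀ v, G.degree v = k)
    (heven : ∀ v, ∀ i : Fin n, 2 ∣ ∑ u ∈ G.neighborFinset v, (u : ℕ) / 2 ^ (i : ℕ)) :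
    ExistsOpenXorMagic n k := by
  obtain ⟨ℓ, hℓ⟩ : ∃ ℓ : Fin (2 ^ n) ≃ (Fin n → ZMod 2),
      ∀ u i, ℓ u i = ((u / 2 ^ (i : ℕ) : ℕ) : ZMod 2) :=
    ⟨(finFunctionFinEquiv (m := 2) (n := n)).symm, fun _ _ =>
      ZMod.val_injective 2 (ZMod.val_natCast 2 _).symm⟩
  refine ⟨G, G.connected_of_exists_adj_lt hconn, fun v => ?_, ℓ, fun v => ?_⟩
  · rw [Set.ncard_eq_toFinset_card', ← hdeg v, SimpleGraph.degree, SimpleGraph.neighborFinset]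
  · rw [← SimpleGraph.coe_neighborFinset, finsum_mem_coe_finset]
    ext i
    rw [Finset.sum_apply, Pi.zero_apply, Finset.sum_congr rfl fun u _ => hℓ u i,
      ← Nat.cast_sum, ZMod.natCast_eq_zero_iff]
    exact heven v i

theorem existsOpenXorMagic_4_5 : ExistsOpenXorMagic 4 5 :=
  existsOpenXorMagic_of_even (graphOfRows (2 ^ 4)
    [1, 3, 6, 6, 3, 28, 32, 208, 8, 769, 544, 649, 6256, 3712, 19840])
    (by decide +kernel) (by decide +kernel) (by decide +kernel)

theorem existsOpenXorMagic_4_7 : ExistsOpenXorMagic 4 7 :=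
  existsOpenXorMagic_of_even (graphOfRows (2 ^ 4)
    [1, 3, 7, 15, 13, 3, 81, 76, 112, 456, 1700, 3360, 5826, 5010, 31520])
    (by decide +kernel) (by decide +kernel) (by decide +kernel)

theorem existsOpenXorMagic_4_9 : ExistsOpenXorMagic 4 9 :=
  existsOpenXorMagic_of_even (graphOfRows (2 ^ 4)
    [1, 3, 7, 15, 15, 46, 94, 199, 338, 308, 1681, 4033, 4008, 15913, 32368])
    (by decide +kernel) (by decide +kernel) (by decide +kernel)

theorem existsOpenXorMagic_4_11 : ExistsOpenXorMagic 4 11 :=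
  existsOpenXorMagic_of_even (graphOfRows (2 ^ 4)
    [1, 3, 7, 15, 31, 51, 115, 79, 485, 911, 2005, 2010, 7100, 15996, 32234])
    (by decide +kernel) (by decide +kernel) (by decide +kernel)

theorem existsOpenXorMagic_5_5 : ExistsOpenXorMagic 5 5 :=
  existsOpenXorMagic_of_even (graphOfRows (2 ^ 5)
    [1, 2, 4, 8, 4, 16, 42, 32, 321, 256, 4, 20, 4096, 2113, 2048, 32768, 11264, 6145, 98304,
     81985, 33296, 73728, 139360, 5506048, 4739200, 16777258, 656136, 6300688, 558336,
     539033728, 1149501442])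
    (by decide +kernel) (by decide +kernel) (by decide +kernel)

theorem existsOpenXorMagic_5_7 : ExistsOpenXorMagic 5 7 :=
  existsOpenXorMagic_of_even (graphOfRows (2 ^ 5)
    [1, 1, 2, 6, 19, 53, 4, 17, 256, 2, 96, 136, 4108, 128, 2048, 25105, 91136, 55298, 45152,
     4232, 1081356, 1664, 541440, 6455313, 23380224, 14172674, 11535456, 1055880, 276826892,
     427904, 138619904])
    (by decide +kernel) (by decide +kernel) (by decide +kernel)

theorem existsOpenXorMagic_5_9 : ExistsOpenXorMagic 5 9 :=
  existsOpenXorMagic_of_even (graphOfRows (2 ^ 5)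
    [1, 3, 7, 15, 31, 7, 56, 64, 384, 784, 2016, 1792, 2828, 4866, 20481, 64, 77952, 205072,
     460256, 459776, 753676, 1265666, 5304321, 3136, 19923072, 52500496, 117768416, 117752320,
     192972300, 324059138, 1357946881])
    (by decide +kernel) (by decide +kernel) (by decide +kernel)

theorem existsOpenXorMagic_5_11 : ExistsOpenXorMagic 5 11 :=
  existsOpenXorMagic_of_even (graphOfRows (2 ^ 5)
    [1, 3, 7, 15, 29, 32, 66, 194, 472, 770, 1864, 3856, 3876, 5541, 12289, 194, 66776, 213250,
     500808, 999952, 1020196, 1409189, 3201025, 9410, 17043672, 54594050, 128221256, 256024592,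
     261163044, 360748197, 819521537])
    (by decide +kernel) (by decide +kernel) (by decide +kernel)

theorem existsOpenXorMagic_5_13 : ExistsOpenXorMagic 5 13 :=
  existsOpenXorMagic_of_even (graphOfRows (2 ^ 5)
    [1, 3, 7, 15, 30, 30, 30, 222, 483, 773, 1832, 3856, 8128, 15904, 27649, 1246, 102627,
     235525, 466984, 993296, 2035904, 4114720, 7139329, 278750, 26214627, 60293381, 119559208,
     254322192, 521181376, 1053409312, 1827718657])
    (by decide +kernel) (by decide +kernel) (by decide +kernel)

theorem existsOpenXorMagic_5_15 : ExistsOpenXorMagic 5 15 :=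
  existsOpenXorMagic_of_even (graphOfRows (2 ^ 5)
    [1, 1, 3, 8, 20, 20, 98, 127, 23, 179, 465, 908, 96, 44, 8394, 23679, 30231, 29363, 129233,
     208268, 30304, 48684, 2158538, 6066303, 7792151, 7533491, 33085905, 53309324, 7798368,
     12496684, 552585418])
    (by decide +kernel) (by decide +kernel) (by decide +kernel)

theorem existsOpenXorMagic_5_27 : ExistsOpenXorMagic 5 27 :=
  existsOpenXorMagic_of_even (graphOfRows (2 ^ 5)
    [1, 3, 5, 15, 30, 59, 111, 255, 255, 1013, 1903, 4027, 8158, 15871, 16127, 65023, 32767,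
     261109, 522095, 1044411, 2088926, 4046847, 4128511, 16613375, 8388351, 66845685, 133691247,
     267382715, 534765534, 1035976703, 1056898559])
    (by decide +kernel) (by decide +kernel) (by decide +kernel)

theorem existsOpenXorMagic_6_9 : ExistsOpenXorMagic 6 9 :=
  existsOpenXorMagic_of_even (graphOfRows (2 ^ 6)
    [1, 1, 1, 2, 16, 32, 32, 4, 64, 768, 1088, 8, 2240, 2048, 28672, 560, 82432, 32, 327936,
     854048, 393216, 2236416, 262400, 65604, 5440, 82078, 16777239, 8472160, 3, 671088640,
     1258815488, 17664, 4832890880, 4302323840, 8605664256, 4336962688, 8623489024, 1677721605,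
     415672303616, 47246746624, 105235091456, 51544457216, 4415247351872, 141776390152,
     18280454553869, 139586476048, 4831839118, 36992, 16492674449408, 845799338541072,
     295768629969536, 354051338280962, 281750391509518, 4504150456930315, 139871658288,
     354042744185504, 18050271821168640, 203858252998377472, 144256750802436105,
     1974722884436032, 2278188099438592, 72622880747421712, 2308666580845068288])
    (by decide +kernel) (by decide +kernel) (by decide +kernel)

theorem existsOpenXorMagic_7_13 : ExistsOpenXorMagic 7 13 :=
  existsOpenXorMagic_of_even (graphOfRows (2 ^ 7)
    [1, 2, 5, 10, 29, 42, 125, 8, 8, 152, 512, 512, 4673, 8883, 194, 4128, 10272, 136907, 4622,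
     104, 163840, 135168, 4624389, 4194432, 10535040, 37810432, 105382417, 173146159, 4335666,
     16548, 34079232, 2147559424, 2097152, 12884912448, 8589934608, 42983293952, 13958643712,
     240551788544, 236239978496, 1047972020224, 932007903232, 3475702284288, 3380142145602,
     4398046511104, 17733919965184, 17593259786240, 89060443955200, 246290671730688,
     510173396336640, 879678961745920, 2234207627640832, 4468415263670272, 7621814603743488,
     6781787726413824, 10133100252103680, 27039361748961280, 114842065375855360, 35203703636288,
     396351952654434304, 36038142884579332, 1152930300704604417, 524288, 108092164029814272,
     4611686018454652928, 216172784261267456, 4611686018444165632, 55359372519544979712,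
     202914202403001663492, 110824579647513034816, 848622566459671839232, 280177940292851205120,
     2951479054001143545856, 4796153460848110796800, 4611704719251865600,
     4801918066696112996352, 295724366498659108868, 80285139133786551747584,
     147582964186979762448, 302238372573440207290369, 41837215699910751420416,
     2011127449607158628352, 1153629899332781056, 6044629098075347052658688,
     3667526316502711923639296, 4534707755407800897896454, 33854645315973961513697280,
     77600305730577898584145920, 169249615322508841057259520, 401363372112078877308747776,
     116061601051745669515051008, 500575747100576972801280, 3559078794690010512890060800,
     7364785537825286705960189952, 17190934613488050659028631552, 33211614838856167304145731584,
     18889466212955841364224, 14181006566457278990336, 158765814760716503126531768576,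
     238923334350230080322251259904, 950737969061214513859594944768,
     1194612137910824310841882509312, 2773063059254301225463243079696,
     1743019585054419196085547302916, 151134174213563266105344,
     20282506317717248671849226699776, 60847228867623409066277496430592,
     141979962075661635800574933860352, 81139563695585717837184909711360,
     162259276923660702091355616247808, 791330887494703658788524034654208,
     1926828912347499004099746087305216, 497552863007468572804941233520640,
     8519879685343593496839161823363072, 651612041941389382940614107136064,
     20769187444434366900526138173460481, 78599121392265014974382080,
     5842601616773067130325189169512448, 5070602552471979407332853420048,
     338148372527465943960787896964743168, 166163323774937664780016474189201408,
     14340297500121425496962523725824, 8315788246982199307412427312726016,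
     6317829331592295026512488030162386944, 5319650109084443601973592668526084096,
     27916526036782144160432324880763979776, 9470922583502619263188836419843915776,
     4050316622807961576830933447619954706])
    (by decide +kernel) (by decide +kernel) (by decide +kernel)

theorem stmt_16 (n k : ℕ)
    (hnk : (n = 4 ∧ k ∈ ({5, 7, 9, 11} : Set ℕ)) ∨
           (n = 5 ∧ k ∈ ({5, 7, 9, 11, 13, 15, 27} : Set ℕ)) ∨
           (n = 6 ∧ k = 9) ∨
           (n = 7 ∧ k = 13)) :
    ∃ G : SimpleGraph (Fin (2 ^ n)),
      G.Connected ∧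
      (∀ v, (G.neighborSet v).ncard = k) ∧
      ∃ ℓ : Fin (2 ^ n) ≃ (Fin n → ZMod 2),
        ∀ v, ∑ᶠ u ∈ G.neighborSet v, ℓ u = 0 := by
  simp only [Set.mem_insert_iff, Set.mem_singleton_iff] at hnk
  change ExistsOpenXorMagic n k
  rcases hnk with ⟨rfl, rfl | rfl | rfl | rfl⟩ |
      ⟨rfl, rfl | rfl | rfl | rfl | rfl | rfl | rfl⟩ | ⟨rfl, rfl⟩ | ⟨rfl, rfl⟩
  · exact existsOpenXorMagic_4_5
  · exact existsOpenXorMagic_4_7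
  · exact existsOpenXorMagic_4_9
  · exact existsOpenXorMagic_4_11
  · exact existsOpenXorMagic_5_5
  · exact existsOpenXorMagic_5_7
  · exact existsOpenXorMagic_5_9
  · exact existsOpenXorMagic_5_11
  · exact existsOpenXorMagic_5_13
  · exact existsOpenXorMagic_5_15
  · exact existsOpenXorMagic_5_27
  · exact existsOpenXorMagic_6_9
  · exact existsOpenXorMagic_7_13
end

section
/- For each of the following pairs (n,k) — n = 4 with k ∈ {4,6,8,10}; n = 5 with k ∈ {4,16,18,20,22,24,26}; n = 6 with k = 54; n = 7 with k = 114 — there exists a connected k-regular simple graph G on 2^n vertices together with a bijection ℓ from V(G) to (Z_2)^n such that for every vertex v the sum in (Z_2)^n of ℓ(u) over all vertices u of the closed neighborhood N[v] = N(v) ∪ {v} is the zero vector (i.e., a k-regular closed XOR-magic graph of power n exists). -/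
/-- The graph on `Fin (2 ^ n)` coded by a list of numbers: for `v < u`, the vertices `u` and `v` are
adjacent when bit `v` of the `u`-th number is set. -/
def codeGraph (n : ℕ) (rows : List ℕ) : SimpleGraph (Fin (2 ^ n)) :=
  SimpleGraph.fromRel fun u v => (rows.getD u 0).testBit v

/-- Membership of `u` in the closed neighborhood of `v` in the graph coded by `rows`. -/
def inClosedNbhd (rows : List ℕ) (v u : ℕ) : Bool :=
  u == v || (rows.getD v 0).testBit u || (rows.getD u 0).testBit v

/-- The bitwise exclusive or of all `i < m` satisfying `p`. -/
def xorBelow (p : ℕ → Bool) : ℕ → ℕ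
  | 0 => 0
  | m + 1 => bif p m then m ^^^ xorBelow p m else xorBelow p m

/-- The first `n` binary digits of a natural number, as a vector over `ZMod 2`. -/
def bitVector (n m : ℕ) : Fin n → ZMod 2 := fun j => if m.testBit j then 1 else 0

lemma bitVector_zero (n : ℕ) : bitVector n 0 = 0 := by
  ext j
  simp [bitVector]

lemma bitVector_xor (n a b : ℕ) : bitVector n (a ^^^ b) = bitVector n a + bitVector n b := by
  ext j
  simp only [bitVector, Nat.testBit_xor, Pi.add_apply]
  cases a.testBit j <;> cases b.testBit j <;> decide

lemma bitVector_injective (n : ℕ) :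
    Function.Injective fun v : Fin (2 ^ n) => bitVector n v := by
  intro a b hab
  refine Fin.ext (Nat.eq_of_testBit_eq fun i => ?_)
  by_cases hi : i < n
  · have h := congrFun hab ⟨i, hi⟩
    simp only [bitVector] at h
    revert h
    cases (a : ℕ).testBit i <;> cases (b : ℕ).testBit i <;> simp
  · have hle : 2 ^ n ≤ 2 ^ i := Nat.pow_le_pow_right two_pos (not_lt.mp hi)
    rw [Nat.testBit_lt_two_pow (a.isLt.trans_le hle), Nat.testBit_lt_two_pow (b.isLt.trans_le hle)]

/-- The labeling of `Fin (2 ^ n)` by binary digits. -/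
noncomputable def bitLabeling (n : ℕ) : Fin (2 ^ n) ≃ (Fin n → ZMod 2) :=
  Equiv.ofBijective (fun v => bitVector n v)
    ((Fintype.bijective_iff_injective_and_card _).2 ⟨bitVector_injective n, by simp [ZMod.card]⟩)

lemma sum_bitVector_eq_bitVector_xorBelow (n : ℕ) (p : ℕ → Bool) (m : ℕ) :
    ∑ i ∈ Finset.range m, (if p i then bitVector n i else 0) = bitVector n (xorBelow p m) := by
  induction m with
  | zero => simp [xorBelow, bitVector_zero]
  | succ m ih =>
    rw [Finset.sum_range_succ, ih, xorBelow]
    cases p m <;> simp [bitVector_xor, add_comm]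

lemma insert_neighborSet_codeGraph (n : ℕ) (rows : List ℕ) (v : Fin (2 ^ n)) :
    insert v ((codeGraph n rows).neighborSet v) = {u : Fin (2 ^ n) | inClosedNbhd rows v u} := by
  ext u
  simp only [codeGraph, inClosedNbhd, Set.mem_insert_iff, SimpleGraph.mem_neighborSet,
    SimpleGraph.fromRel_adj, Set.mem_ofPred_eq, Bool.or_eq_true, beq_iff_eq, Fin.val_inj]
  tauto

lemma ncard_neighborSet_codeGraph (n : ℕ) (rows : List ℕ) (v : Fin (2 ^ n)) :
    ((codeGraph n rows).neighborSet v).ncard + 1 =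
      Nat.count (fun u => inClosedNbhd rows v u) (2 ^ n) := by
  rw [← Set.ncard_insert_of_notMem (by simp : v ∉ (codeGraph n rows).neighborSet v),
    insert_neighborSet_codeGraph, Nat.count_eq_card_filter_range, Finset.card_filter,
    ← Fin.sum_univ_eq_sum_range (fun u => if inClosedNbhd rows v u then 1 else 0),
    ← Finset.card_filter, Set.ncard_eq_toFinset_card']
  simp

lemma finsum_bitLabeling_codeGraph (n : ℕ) (rows : List ℕ) (v : Fin (2 ^ n)) :
    ∑ᶠ u ∈ insert v ((codeGraph n rows).neighborSet v), bitLabeling n u =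
      bitVector n (xorBelow (inClosedNbhd rows v) (2 ^ n)) := by
  rw [insert_neighborSet_codeGraph, ← sum_bitVector_eq_bitVector_xorBelow,
    ← Fin.sum_univ_eq_sum_range (fun u => if inClosedNbhd rows v u then bitVector n u else 0),
    finsum_mem_def, finsum_eq_sum_of_fintype]
  refine Finset.sum_congr rfl fun u _ => ?_
  simp only [Set.indicator_apply, Set.mem_ofPred_eq]
  rfl

lemma SimpleGraph.connected_of_forall_exists_lt_adj {m : ℕ} [NeZero m] (G : SimpleGraph (Fin m))
    (h : ∀ u : Fin m, u ≠ 0 → ∃ v < u, G.Adj u v) : G.Connected := by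
  have reach : ∀ u : Fin m, G.Reachable u 0 := by
    intro u
    induction u using WellFoundedLT.induction with
    | ind u ih =>
      by_cases hu : u = 0
      · rw [hu]
      · obtain ⟨v, hvu, hadj⟩ := h u hu
        exact hadj.reachable.trans (ih v hvu)
  exact (SimpleGraph.connected_iff _).2 ⟨fun u v => (reach u).trans (reach v).symm, ⟨0⟩⟩

/-- The conditions on `rows` making `codeGraph n rows` a `k`-regular closed XOR-magic graph
labeled by binary digits. -/
def IsMagicCode (n k : ℕ) (rows : List ℕ) : Prop :=
  ∀ v < 2 ^ n, (v ≠ 0 → rows.getD v 0 ≠ 0) ∧ rows.getD v 0 < 2 ^ v ∧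
    Nat.count (fun u => inClosedNbhd rows v u) (2 ^ n) = k + 1 ∧
    xorBelow (inClosedNbhd rows v) (2 ^ n) = 0

instance (n k : ℕ) (rows : List ℕ) : Decidable (IsMagicCode n k rows) :=
  inferInstanceAs (Decidable (∀ v < 2 ^ n, _))

lemma connected_codeGraph {n : ℕ} {rows : List ℕ}
    (hne : ∀ v < 2 ^ n, v ≠ 0 → rows.getD v 0 ≠ 0) (hlt : ∀ v < 2 ^ n, rows.getD v 0 < 2 ^ v) :
    (codeGraph n rows).Connected := by
  refine SimpleGraph.connected_of_forall_exists_lt_adj _ fun u hu => ?_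
  have hu' : (u : ℕ) ≠ 0 := fun h => hu (Fin.ext h)
  obtain ⟨i, hi⟩ := Nat.exists_testBit_of_ne_zero (hne u u.isLt hu')
  have hiu : i < u := by
    by_contra hle
    have := Nat.testBit_lt_two_pow
      ((hlt u u.isLt).trans_le (Nat.pow_le_pow_right two_pos (not_lt.mp hle)))
    simp_all
  exact ⟨⟨i, hiu.trans u.isLt⟩, hiu, (SimpleGraph.fromRel_adj _ _ _).2
    ⟨fun h => hiu.ne' (congrArg Fin.val h), Or.inl hi⟩⟩

/-- There is a `k`-regular closed XOR-magic graph of power `n`. -/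
def HasRegularMagicGraph (n k : ℕ) : Prop :=
  ∃ G : SimpleGraph (Fin (2 ^ n)),
    G.Connected ∧
    (∀ v, (G.neighborSet v).ncard = k) ∧
    ∃ ℓ : Fin (2 ^ n) ≃ (Fin n → ZMod 2),
      ∀ v, ∑ᶠ u ∈ insert v (G.neighborSet v), ℓ u = 0

theorem IsMagicCode.hasRegularMagicGraph {n k : ℕ} {rows : List ℕ} (h : IsMagicCode n k rows) :
    HasRegularMagicGraph n k := by
  refine ⟨codeGraph n rows,
    connected_codeGraph (fun v hv => (h v hv).1) (fun v hv => (h v hv).2.1), fun v => ?_,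
    bitLabeling n, fun v => ?_⟩
  · exact Nat.succ_injective ((ncard_neighborSet_codeGraph n rows v).trans (h v v.isLt).2.2.1)
  · rw [finsum_bitLabeling_codeGraph, (h v v.isLt).2.2.2, bitVector_zero]

theorem hasRegularMagicGraph_4_4 : HasRegularMagicGraph 4 4 :=
  IsMagicCode.hasRegularMagicGraph (rows :=
    [0, 1, 1, 4, 2, 8, 16, 96, 32, 161, 73, 514, 2308, 4244, 282, 3392])
    (by decide +kernel)

theorem hasRegularMagicGraph_4_6 : HasRegularMagicGraph 4 6 :=
  IsMagicCode.hasRegularMagicGraph (rows :=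
    [0, 1, 3, 7, 7, 16, 32, 72, 42, 389, 224, 800, 3154, 3397, 6320, 18120])
    (by decide +kernel)

theorem hasRegularMagicGraph_4_8 : HasRegularMagicGraph 4 8 :=
  IsMagicCode.hasRegularMagicGraph (rows :=
    [0, 1, 2, 4, 8, 16, 44, 77, 224, 223, 423, 497, 827, 3127, 15642, 383])
    (by decide +kernel)

theorem hasRegularMagicGraph_4_10 : HasRegularMagicGraph 4 10 :=
  IsMagicCode.hasRegularMagicGraph (rows :=
    [0, 1, 2, 4, 8, 25, 59, 83, 254, 503, 287, 1471, 1709, 4350, 13917, 31911])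
    (by decide +kernel)

theorem hasRegularMagicGraph_5_4 : HasRegularMagicGraph 5 4 :=
  IsMagicCode.hasRegularMagicGraph (rows :=
    [0, 1, 1, 2, 8, 2, 16, 2, 4, 256, 512, 128, 1024, 33, 4097, 2112, 4132, 16384, 64, 17416,
    524544, 1048584, 401408, 131968, 4198400, 16812064, 1050756, 16875520, 134219280, 2359312,
    537010176, 1076101184])
    (by decide +kernel)

theorem hasRegularMagicGraph_5_16 : HasRegularMagicGraph 5 16 :=
  IsMagicCode.hasRegularMagicGraph (rows :=
    [0, 1, 3, 5, 5, 14, 59, 4, 211, 414, 758, 502, 3637, 7111, 7090, 12764, 50699, 111465,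
    55448, 344307, 1031304, 1943849, 3900313, 4859872, 10373649, 28509356, 65421390, 114068898,
    262415676, 400420865, 1025856626, 1258381007])
    (by decide +kernel)

theorem hasRegularMagicGraph_5_18 : HasRegularMagicGraph 5 18 :=
  IsMagicCode.hasRegularMagicGraph (rows :=
    [0, 1, 3, 1, 15, 31, 46, 63, 114, 253, 1023, 1019, 4091, 7867, 3550, 17981, 64254, 108676,
    200976, 410345, 920330, 2019653, 4085153, 1436485, 7255314, 29330500, 50213132, 122970859,
    95850263, 534683724, 1073660290, 805298496])
    (by decide +kernel)

theorem hasRegularMagicGraph_5_20 : HasRegularMagicGraph 5 20 :=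
  IsMagicCode.hasRegularMagicGraph (rows :=
    [0, 1, 3, 7, 15, 30, 4, 95, 228, 508, 767, 2010, 3031, 5615, 15311, 30671, 44231, 60676,
    229177, 457106, 783987, 259419, 2087989, 7982960, 3117562, 29033957, 64946938, 126315055,
    250554723, 527047657, 1006504764, 2146636409])
    (by decide +kernel)

theorem hasRegularMagicGraph_5_22 : HasRegularMagicGraph 5 22 :=
  IsMagicCode.hasRegularMagicGraph (rows :=
    [0, 1, 1, 7, 13, 31, 63, 58, 230, 479, 1004, 1443, 4043, 7671, 16378, 8094, 45053, 122356,
    84431, 384957, 964555, 473851, 3660339, 8321878, 16684977, 29877756, 57028319, 133553526,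
    129821759, 503020071, 914270687, 2136995341])
    (by decide +kernel)

theorem hasRegularMagicGraph_5_24 : HasRegularMagicGraph 5 24 :=
  IsMagicCode.hasRegularMagicGraph (rows :=
    [0, 1, 2, 3, 14, 31, 59, 76, 243, 479, 947, 1919, 1983, 7359, 12255, 13743, 55742, 129011,
    196588, 350207, 785885, 2091751, 2097067, 4190047, 12446711, 15724492, 62847708, 107452415,
    268418421, 258438911, 1064419069, 1876532735])
    (by decide +kernel)

theorem hasRegularMagicGraph_5_26 : HasRegularMagicGraph 5 26 :=
  IsMagicCode.hasRegularMagicGraph (rows :=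
    [0, 1, 3, 5, 11, 5, 62, 125, 111, 510, 1023, 1023, 4093, 5885, 14206, 32759, 63983, 97275,
    261247, 475103, 1043447, 2096927, 4159483, 8351679, 16768447, 30797823, 66772415, 87027711,
    251395834, 529989630, 1047395327, 2147465187])
    (by decide +kernel)

theorem hasRegularMagicGraph_6_54 : HasRegularMagicGraph 6 54 :=
  IsMagicCode.hasRegularMagicGraph (rows :=
    [0, 1, 3, 7, 15, 31, 63, 109, 255, 187, 895, 1855, 4095, 5439, 10135, 32255, 65535, 119178,
    229247, 523003, 949375, 1835007, 4193009, 8384494, 16769023, 33550333, 67107583, 50323455,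
    251658239, 536870878, 503316479, 1073741811, 2143027199, 8519577591, 17179808438,
    34342960607, 66756542463, 136860139509, 271639903230, 136230731775, 1095180922335,
    2198977052398, 4363348344831, 8793945239537, 17523432488895, 17591246454719, 69818971586539,
    105553082347519, 272506873708543, 545356620151807, 979660546506701, 2251799813637916,
    4433221454133247, 8936791584800719, 4468066154969087, 36011202592112375, 67394770978209791,
    108050620690202623, 144042344889384953, 432327282296586238, 1152565258543938415,
    2305842837406547905, 4611604648116088574, 9222663839693668351])
    (by decide +kernel)

theorem hasRegularMagicGraph_7_114 : HasRegularMagicGraph 7 114 :=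
  IsMagicCode.hasRegularMagicGraph (rows :=
    [0, 1, 3, 7, 15, 27, 63, 127, 223, 511, 951, 2047, 3071, 8159, 16383, 30701, 65525, 131071,
    228602, 524287, 786175, 2096123, 4194175, 7061485, 16760831, 33521661, 40890367, 134184703,
    230586367, 267775999, 805265407, 2113929077, 4294967289, 8572633087, 16626221055,
    34317774806, 63753412575, 137430564345, 180355071983, 480394084255, 1065117282303,
    1064615018107, 4396955959287, 8727373544959, 17592183947135, 35184355307487, 70162451529691,
    119846767427567, 281474976710643, 490382185986924, 1108298056597503, 2233932749733887,
    4499201443888639, 4503598553628415, 17996806021446639, 35993611034950647, 35711862792256447,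
    71837408242430975, 252199380109475827, 500955088450092799, 1143279887141830639,
    2233785414102007807, 3449194087586721271, 9223353894896140253, 18428694490693752766,
    36819177645465927663, 72632928890055950079, 147573952503775490047, 221360647408462069759,
    442433486238777343855, 1180578100984976113663, 2361183096294992767982,
    2213609283897343803391, 8845204494669498515182, 18851698463526327680255,
    35415154521731430875135, 66066869784798388289535, 141668681729348875583487,
    281866249446281879416542, 602027939589444736036863, 1208925819541784113283006,
    1170704164627115264704511, 4835666382717950852333471, 9501251483597348989304317,
    14507109794834357309399021, 38684408740298397973463039, 77366232490915249806835711,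
    153831088174957500888121343, 309333598945985844454604415, 464227514729760163979319294,
    1237897501089887117318815743, 2471044355960565379519987711, 4951433723558357549923172285,
    4864339690363894110724536319, 18569100548928306326712319933, 39572977778094016634749452095,
    79187059031173264410515863518, 138648678719557822847656116219,
    237645646041279276851039567871, 633747928787656171423753171967,
    1265174018878217915458278914043, 2218347446916903720114218530303,
    3642009921496252254589894516607, 10140579787094075093159349581787,
    19648584303535249797717673639611, 40563813302512074159877739511807,
    78594332340591343286867336232831, 157188635662384728225259903254527,
    324512363952322727699604379266431, 648403262673907688215427818585983,
    1257509240683887990802404580646846, 2585999487113595066005881215057919,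
    5110830500429534960860164180139006, 10222314594514037202106866749890559,
    20759036325778727092979029480505207, 36264908755962191523911321974669311,
    80479332263893719011609366436363759, 165178675852052342559394133284749311,
    321902106726335132141743563490721279, 664573413111467490410926646703880126,
    1328578957129559167889539587614171127, 2491003704818949372277587753299860471,
    5275292161720320204542058809771139071, 9283177587496615732279589655243128255,
    21257263336365704224525398231920666615, 31901390769039912280655699187517554687,
    84404192879678037933384101694535630847, 164824270803809037566386249302034873855])
    (by decide +kernel)

theorem stmt_17 (n k : ℕ)
    (hnk : (n = 4 ∧ k ∈ ({4, 6, 8, 10} : Set ℕ)) ∨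
           (n = 5 ∧ k ∈ ({4, 16, 18, 20, 22, 24, 26} : Set ℕ)) ∨
           (n = 6 ∧ k = 54) ∨
           (n = 7 ∧ k = 114)) :
    ∃ G : SimpleGraph (Fin (2 ^ n)),
      G.Connected ∧
      (∀ v, (G.neighborSet v).ncard = k) ∧
      ∃ ℓ : Fin (2 ^ n) ≃ (Fin n → ZMod 2),
        ∀ v, ∑ᶠ u ∈ insert v (G.neighborSet v), ℓ u = 0 := by
  rcases hnk with ⟨rfl, rfl | rfl | rfl | rfl⟩ | ⟨rfl, rfl | rfl | rfl | rfl | rfl | rfl | rfl⟩ |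
    ⟨rfl, rfl⟩ | ⟨rfl, rfl⟩
  · exact hasRegularMagicGraph_4_4
  · exact hasRegularMagicGraph_4_6
  · exact hasRegularMagicGraph_4_8
  · exact hasRegularMagicGraph_4_10
  · exact hasRegularMagicGraph_5_4
  · exact hasRegularMagicGraph_5_16
  · exact hasRegularMagicGraph_5_18
  · exact hasRegularMagicGraph_5_20
  · exact hasRegularMagicGraph_5_22
  · exact hasRegularMagicGraph_5_24
  · exact hasRegularMagicGraph_5_26
  · exact hasRegularMagicGraph_6_54
  · exact hasRegularMagicGraph_7_114
end
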